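/- arXiv:2411.09530 — 9 statements merged into one kernel-verified Lean document; each statement's English description precedes it below -/
import Mathlib

section
/- ((+)-discrete Dirac structures are Dirac structures.) Fix a base point x₁ ∈ ℝⁿ and represent a pair (x₀,x₁) over x₁ by its first component x₀. Define D⁺(x₁) = {(x₀,α) ∈ ℝⁿ × (ℝⁿ)* : (x₁−x₀)/h ∈ Δ(x₁) and α(w) = Ω(x₁)((x₁−x₀)/h, w) for all w ∈ Δ(x₁)}, and its orthogonal (D⁺(x₁))^⊥ = {(y₀,β) ∈ ℝⁿ × (ℝⁿ)* : α((x₁−y₀)/h) + β((x₁−x₀)/h) = 0 for all (x₀,α) ∈ D⁺(x₁)}. Then D⁺(x₁) = (D⁺(x₁))^⊥. -/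
/-- The (+)-discrete Dirac structure at a base point `x₁ ∈ ℝⁿ` is a Dirac
structure: `D⁺(x₁) = (D⁺(x₁))^⊥` with respect to the (+)-discrete pairing
`⟨α,(x₀,x₁)⟩ = α ((x₁ - x₀)/h)`. -/
theorem plus_discrete_dirac_structure (n : ℕ) (h : ℝ) (hh : 0 < h)
    (Ω : (Fin n → ℝ) → (Fin n → ℝ) →ₗ[ℝ] (Fin n → ℝ) →ₗ[ℝ] ℝ)
    (hΩ : ∀ x v w, Ω x v w = - Ω x w v)
    (Δ : (Fin n → ℝ) → Submodule ℝ (Fin n → ℝ))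
    (x₁ : Fin n → ℝ)
    (D : Set ((Fin n → ℝ) × Module.Dual ℝ (Fin n → ℝ)))
    (hD : D = {p : (Fin n → ℝ) × Module.Dual ℝ (Fin n → ℝ) |
        h⁻¹ • (x₁ - p.1) ∈ Δ x₁ ∧
        ∀ w ∈ Δ x₁, p.2 w = Ω x₁ (h⁻¹ • (x₁ - p.1)) w}) :
    D = {p : (Fin n → ℝ) × Module.Dual ℝ (Fin n → ℝ) |
        ∀ q ∈ D, q.2 (h⁻¹ • (x₁ - p.1)) + p.2 (h⁻¹ • (x₁ - q.1)) = 0} := by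
  subst hD
  ext ⟨y, β⟩
  simp only [Set.mem_setOf_eq]
  constructor
  · rintro ⟨h1, h2⟩ ⟨x, α⟩ ⟨h3, h4⟩
    dsimp only at *
    rw [h4 _ h1, h2 _ h3, hΩ x₁ (h⁻¹ • (x₁ - x))]
    ring
  · intro H
    have hv : h⁻¹ • (x₁ - y) ∈ Δ x₁ := by
      by_contra hn
      obtain ⟨f, hf, hfD⟩ := Submodule.exists_le_ker_of_notMem hn
      have := H (x₁, f) ⟨by simp, fun w hw => by
        have := hfD hw
        simpa using this⟩
      simp only [sub_self, smul_zero, map_zero, add_zero] at this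
      exact hf this
    refine ⟨hv, fun w hw => ?_⟩
    have e : h⁻¹ • (x₁ - (x₁ - h • w)) = w := by
      rw [sub_sub_cancel, smul_smul, inv_mul_cancel₀ hh.ne', one_smul]
    have := H (x₁ - h • w, Ω x₁ w) (by
      dsimp only
      rw [e]
      exact ⟨hw, fun _ _ => rfl⟩)
    dsimp only at this
    rw [e] at this
    rw [hΩ]
    linarith
end

section
/- ((−)-discrete Dirac structures are Dirac structures.) Fix a base point x₀ ∈ ℝⁿ and represent a pair (x₀,x₁) over x₀ by its second component x₁. Define D⁻(x₀) = {(x₁,α) ∈ ℝⁿ × (ℝⁿ)* : (x₁−x₀)/h ∈ Δ(x₀) and α(w) = Ω(x₀)((x₁−x₀)/h, w) for all w ∈ Δ(x₀)}, and its orthogonal (D⁻(x₀))^⊥ = {(y₁,β) ∈ ℝⁿ × (ℝⁿ)* : α((y₁−x₀)/h) + β((x₁−x₀)/h) = 0 for all (x₁,α) ∈ D⁻(x₀)}. Then D⁻(x₀) = (D⁻(x₀))^⊥. -/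
/-- The (−)-discrete Dirac structure at a base point `x₀ ∈ ℝⁿ` is a Dirac
structure: `D⁻(x₀) = (D⁻(x₀))^⊥` with respect to the (−)-discrete pairing
`⟨α,(x₀,x₁)⟩ = α ((x₁ - x₀)/h)`. -/
theorem minus_discrete_dirac_structure (n : ℕ) (h : ℝ) (hh : 0 < h)
    (Ω : (Fin n → ℝ) → (Fin n → ℝ) →ₗ[ℝ] (Fin n → ℝ) →ₗ[ℝ] ℝ)
    (hΩ : ∀ x v w, Ω x v w = - Ω x w v)
    (Δ : (Fin n → ℝ) → Submodule ℝ (Fin n → ℝ))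
    (x₀ : Fin n → ℝ)
    (D : Set ((Fin n → ℝ) × Module.Dual ℝ (Fin n → ℝ)))
    (hD : D = {p : (Fin n → ℝ) × Module.Dual ℝ (Fin n → ℝ) |
        h⁻¹ • (p.1 - x₀) ∈ Δ x₀ ∧
        ∀ w ∈ Δ x₀, p.2 w = Ω x₀ (h⁻¹ • (p.1 - x₀)) w}) :
    D = {p : (Fin n → ℝ) × Module.Dual ℝ (Fin n → ℝ) |
        ∀ q ∈ D, q.2 (h⁻¹ • (p.1 - x₀)) + p.2 (h⁻¹ • (q.1 - x₀)) = 0} := by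
  subst hD
  ext ⟨x, α⟩
  simp only [Set.mem_setOf_eq, Prod.forall]
  constructor
  · rintro ⟨h1, h2⟩ y β ⟨h3, h4⟩
    rw [h4 _ h1, h2 _ h3, hΩ]
    ring
  · intro H
    refine ⟨?_, ?_⟩
    · by_contra hv
      obtain ⟨f, hf, hle⟩ := Submodule.exists_le_ker_of_notMem hv
      have h1 := H x₀ f ⟨by simp, fun w hw => by
        have h2 : f w = 0 := hle hw
        simp [h2]⟩
      rw [sub_self, smul_zero, map_zero, add_zero] at h1
      exact hf h1
    · intro w hw
      have e : h⁻¹ • (x₀ + h • w - x₀) = w := by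
        rw [add_sub_cancel_left, inv_smul_smul₀ hh.ne']
      have h1 := H (x₀ + h • w) (Ω x₀ w) ⟨by rw [e]; exact hw, fun u _ => by rw [e]⟩
      rw [e, hΩ] at h1
      linarith
end

section
/- (The induced Dirac structure on the cotangent bundle is a Dirac structure.) For every q ∈ ℝⁿ, the induced Dirac structure D(q) satisfies D(q) = D(q)^⊥, where D(q)^⊥ = {(Y,β) ∈ V × V* : α(Y) + β(X) = 0 for all (X,α) ∈ D(q)}. -/
/-- The induced Dirac structure on the cotangent bundle is a Dirac structure:
for every `q ∈ ℝⁿ`, `D(q) = D(q)^⊥`.  The phase space is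
`V = ℝⁿ × (ℝⁿ)*`, its dual is identified with `(ℝⁿ)* × ℝⁿ` via
`(β,γ)(w,τ) = β w + τ γ`, and the canonical symplectic form is
`Ω((u,σ),(w,τ)) = τ u − σ w`. -/
theorem induced_dirac_structure_on_cotangent_bundle (n : ℕ)
    (Δ : (Fin n → ℝ) → Submodule ℝ (Fin n → ℝ)) (q : Fin n → ℝ)
    (D : Set (((Fin n → ℝ) × Module.Dual ℝ (Fin n → ℝ)) ×
      (Module.Dual ℝ (Fin n → ℝ) × (Fin n → ℝ))))
    (hD : D = {P | P.1.1 ∈ Δ q ∧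
        ∀ Y : (Fin n → ℝ) × Module.Dual ℝ (Fin n → ℝ), Y.1 ∈ Δ q →
          P.2.1 Y.1 + Y.2 P.2.2 = Y.2 P.1.1 - P.1.2 Y.1}) :
    D = {P | ∀ Q ∈ D,
        (Q.2.1 P.1.1 + P.1.2 Q.2.2) + (P.2.1 Q.1.1 + Q.1.2 P.2.2) = 0} := by
  subst hD
  ext P
  constructor
  · rintro ⟨h1, h2⟩ Q ⟨h3, h4⟩
    have a := h2 Q.1 h3
    have b := h4 P.1 h1
    linarith
  · intro h
    refine ⟨?_, ?_⟩
    · rw [← Subspace.forall_mem_dualAnnihilator_apply_eq_zero_iff]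
      intro φ hφ
      rw [Submodule.mem_dualAnnihilator] at hφ
      have := h ((0, 0), (φ, 0)) ⟨(Δ q).zero_mem, fun Y hY => by simp [hφ _ hY]⟩
      simpa using this
    · intro Y hY
      have := h (Y, (-Y.2, Y.1)) ⟨hY, fun Z _ => by simp; ring⟩
      simp only [LinearMap.neg_apply] at this
      linarith
end

section
/- ((+)-discrete Lagrange–d'Alembert–Pontryagin principle.) Let N ≥ 1, let q₀,…,q_N, v₀,…,v_{N−1} ∈ ℝⁿ and p₁,…,p_N ∈ (ℝⁿ)*, and assume (q_k, v_k) ∈ Δ^{d+} for k = 0,…,N−1. Then the following are equivalent: (a) for every δq₀,…,δq_N ∈ ℝⁿ with δq_k ∈ Δ(q_k) for all k and δq₀ = δq_N = 0, every δv₀,…,δv_{N−1} ∈ ℝⁿ, and every δp₁,…,δp_N ∈ (ℝⁿ)*, the function ε ↦ Σ_{k=0}^{N−1} [ L_d(q_k + ε δq_k, v_k + ε δv_k) + (p_{k+1} + ε δp_{k+1})(q_{k+1} + ε δq_{k+1} − v_k − ε δv_k) ] has derivative 0 at ε = 0; (b) p_{k+1} = D₂L_d(q_k, v_k) and v_k =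 q_{k+1} for k = 0,…,N−1, and p_k + D₁L_d(q_k, v_k) ∈ Δ°(q_k) for k = 1,…,N−1. -/
open scoped BigOperators

/-- Partial Fréchet derivative of `L : ℝⁿ × ℝⁿ → ℝ` with respect to the
first argument, as a continuous linear functional on `ℝⁿ`. -/
noncomputable def D1 {n : ℕ} (L : (Fin n → ℝ) × (Fin n → ℝ) → ℝ)
    (a b : Fin n → ℝ) : (Fin n → ℝ) →L[ℝ] ℝ :=
  fderiv ℝ (fun x => L (x, b)) a

/-- Partial Fréchet derivative of `L : ℝⁿ × ℝⁿ → ℝ` with respect to the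
second argument, as a continuous linear functional on `ℝⁿ`. -/
noncomputable def D2 {n : ℕ} (L : (Fin n → ℝ) × (Fin n → ℝ) → ℝ)
    (a b : Fin n → ℝ) : (Fin n → ℝ) →L[ℝ] ℝ :=
  fderiv ℝ (fun y => L (a, y)) b

/-- The annihilator `Δ°(q)` of the constraint distribution at `q`. -/
def ann {n : ℕ} (Δ : (Fin n → ℝ) → Submodule ℝ (Fin n → ℝ)) (q : Fin n → ℝ) :
    Set ((Fin n → ℝ) →L[ℝ] ℝ) :=
  {φ | ∀ v ∈ Δ q, φ v = 0}

/-- The (+)-discrete constraint space `Δ^{d+} = {(q₀,q₁) : (q₁−q₀)/h ∈ Δ(q₁)}`. -/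
def dPlus {n : ℕ} (h : ℝ) (Δ : (Fin n → ℝ) → Submodule ℝ (Fin n → ℝ)) :
    Set ((Fin n → ℝ) × (Fin n → ℝ)) :=
  {P | h⁻¹ • (P.2 - P.1) ∈ Δ P.2}

/-- The (−)-discrete constraint space `Δ^{d−} = {(q₀,q₁) : (q₁−q₀)/h ∈ Δ(q₀)}`. -/
def dMinus {n : ℕ} (h : ℝ) (Δ : (Fin n → ℝ) → Submodule ℝ (Fin n → ℝ)) :
    Set ((Fin n → ℝ) × (Fin n → ℝ)) :=
  {P | h⁻¹ • (P.2 - P.1) ∈ Δ P.1}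

theorem aux_term {n : ℕ} (L : (Fin n → ℝ) × (Fin n → ℝ) → ℝ) (hL : Differentiable ℝ L)
    (a b c da db dc : Fin n → ℝ) (p dp : (Fin n → ℝ) →L[ℝ] ℝ) :
    HasDerivAt (fun ε : ℝ => L (a + ε • da, b + ε • db) +
      (p + ε • dp) (c + ε • dc - b - ε • db))
      (D1 L a b da + D2 L a b db + (dp (c - b) + p (dc - db))) 0 := by
  have line : ∀ x d : Fin n → ℝ, HasDerivAt (fun ε : ℝ => x + ε • d) d 0 := by
    intro x d
    simpa using ((hasDerivAt_id (0 : ℝ)).smul_const d).const_add x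
  have hf := (hL (a, b)).hasFDerivAt
  have h1 : D1 L a b = (fderiv ℝ L (a, b)).comp (ContinuousLinearMap.inl ℝ _ _) :=
    (hf.comp a (hasFDerivAt_prodMk_left a b)).fderiv
  have h2 : D2 L a b = (fderiv ℝ L (a, b)).comp (ContinuousLinearMap.inr ℝ _ _) :=
    (hf.comp b (hasFDerivAt_prodMk_right a b)).fderiv
  have hA : HasDerivAt (fun ε : ℝ => L (a + ε • da, b + ε • db))
      (fderiv ℝ L (a, b) (da, db)) 0 := by
    refine HasFDerivAt.comp_hasDerivAt (f := fun ε : ℝ => (a + ε • da, b + ε • db)) 0 ?_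
      ((line a da).prodMk (line b db))
    simpa using hf
  have hB : HasDerivAt (fun ε : ℝ => (p + ε • dp) (c + ε • dc - b - ε • db))
      (dp (c - b) + p (dc - db)) 0 := by
    have hp : HasDerivAt (fun ε : ℝ => p + ε • dp) dp 0 := by
      simpa using ((hasDerivAt_id (0 : ℝ)).smul_const dp).const_add p
    have hx : HasDerivAt (fun ε : ℝ => c + ε • dc - b - ε • db) (dc - db) 0 := by
      have := ((line c dc).sub_const b).fun_sub (line 0 db)
      simpa using this
    simpa using hp.clm_apply hx
  have e : fderiv ℝ L (a, b) (da, db) = D1 L a b da + D2 L a b db := by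
    rw [h1, h2]
    simp [← map_add]
  rw [← e]
  exact hA.add hB

theorem aux_sum {n : ℕ} (L : (Fin n → ℝ) × (Fin n → ℝ) → ℝ) (hL : Differentiable ℝ L)
    (N : ℕ) (q v : ℕ → Fin n → ℝ) (p : ℕ → (Fin n → ℝ) →L[ℝ] ℝ)
    (δq : ℕ → Fin n → ℝ) (h0 : δq 0 = 0) (hN : δq N = 0)
    (δv : ℕ → Fin n → ℝ) (δp : ℕ → (Fin n → ℝ) →L[ℝ] ℝ) :
    HasDerivAt (fun ε : ℝ => ∑ k ∈ Finset.range N,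
          (L (q k + ε • δq k, v k + ε • δv k) +
            (p (k + 1) + ε • δp (k + 1))
              (q (k + 1) + ε • δq (k + 1) - v k - ε • δv k)))
      (∑ k ∈ Finset.range N, ((p k + D1 L (q k) (v k)) (δq k) +
        (D2 L (q k) (v k) - p (k + 1)) (δv k) + δp (k + 1) (q (k + 1) - v k))) 0 := by
  have key := HasDerivAt.fun_sum (u := Finset.range N) (fun k _ =>
    aux_term L hL (q k) (v k) (q (k + 1)) (δq k) (δv k) (δq (k + 1)) (p (k + 1)) (δp (k + 1)))
  refine key.congr_deriv (Eq.symm ?_)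
  have t : ∑ k ∈ Finset.range N, p (k + 1) (δq (k + 1)) = ∑ k ∈ Finset.range N, p k (δq k) := by
    have e1 := Finset.sum_range_succ (fun k => p k (δq k)) N
    have e2 := Finset.sum_range_succ' (fun k => p k (δq k)) N
    simp only [h0, hN, map_zero, add_zero] at e1 e2
    rw [← e1, ← e2]
  have t' := sub_eq_zero.2 t
  rw [← Finset.sum_sub_distrib] at t'
  rw [← sub_eq_zero, ← neg_eq_zero, ← t', ← Finset.sum_sub_distrib, ← Finset.sum_neg_distrib]
  refine Finset.sum_congr rfl fun k _ => ?_
  simp only [map_sub, ContinuousLinearMap.add_apply, ContinuousLinearMap.sub_apply]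
  ring

/-- The (+)-discrete Lagrange–d'Alembert–Pontryagin principle: criticality of
the (+)-discrete action sum with respect to constrained variations is
equivalent to the (+)-discrete Lagrange–d'Alembert–Pontryagin equations. -/
theorem plus_discrete_LDAP_principle {n : ℕ} (h : ℝ) (hh : 0 < h)
    (Δ : (Fin n → ℝ) → Submodule ℝ (Fin n → ℝ))
    (L : (Fin n → ℝ) × (Fin n → ℝ) → ℝ) (hL : Differentiable ℝ L)
    (N : ℕ) (hN : 1 ≤ N)
    (q v : ℕ → Fin n → ℝ) (p : ℕ → (Fin n → ℝ) →L[ℝ] ℝ)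
    (hcon : ∀ k < N, (q k, v k) ∈ dPlus h Δ) :
    (∀ δq : ℕ → Fin n → ℝ, (∀ k ≤ N, δq k ∈ Δ (q k)) → δq 0 = 0 → δq N = 0 →
      ∀ δv : ℕ → Fin n → ℝ, ∀ δp : ℕ → (Fin n → ℝ) →L[ℝ] ℝ,
        HasDerivAt (fun ε : ℝ => ∑ k ∈ Finset.range N,
          (L (q k + ε • δq k, v k + ε • δv k) +
            (p (k + 1) + ε • δp (k + 1))
              (q (k + 1) + ε • δq (k + 1) - v k - ε • δv k))) 0 0)
    ↔ ((∀ k < N, p (k + 1) = D2 L (q k) (v k) ∧ v k = q (k + 1)) ∧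
       (∀ k : ℕ, 1 ≤ k → k < N → p k + D1 L (q k) (v k) ∈ ann Δ (q k))) := by
  constructor
  · intro H
    have H' : ∀ δq : ℕ → Fin n → ℝ, (∀ k ≤ N, δq k ∈ Δ (q k)) → δq 0 = 0 → δq N = 0 →
        ∀ δv : ℕ → Fin n → ℝ, ∀ δp : ℕ → (Fin n → ℝ) →L[ℝ] ℝ,
        (∑ k ∈ Finset.range N, ((p k + D1 L (q k) (v k)) (δq k) +
        (D2 L (q k) (v k) - p (k + 1)) (δv k) + δp (k + 1) (q (k + 1) - v k))) = 0 :=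
      fun δq h1 h2 h3 δv δp => (aux_sum L hL N q v p δq h2 h3 δv δp).unique
        (H δq h1 h2 h3 δv δp)
    refine ⟨fun k hk => ⟨?_, ?_⟩, fun k hk1 hk w hw => ?_⟩
    · ext1 w
      have := H' (fun _ => 0) (fun k _ => zero_mem _) rfl rfl
        (fun j => if j = k then w else 0) (fun _ => 0)
      rw [Finset.sum_eq_single_of_mem k (Finset.mem_range.2 hk)
        (fun j _ hj => by simp [hj])] at this
      simp [sub_eq_zero] at this
      exact this.symm
    · ext i
      have := H' (fun _ => 0) (fun k _ => zero_mem _) rfl rfl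
        (fun _ => 0) (fun j => if j = k + 1 then ContinuousLinearMap.proj i else 0)
      rw [Finset.sum_eq_single_of_mem k (Finset.mem_range.2 hk)
        (fun j _ hj => by simp [hj])] at this
      simp [sub_eq_zero] at this
      exact this.symm
    · have := H' (fun j => if j = k then w else 0)
        (fun j _ => by
          by_cases hj : j = k
          · subst hj; simpa using hw
          · simp [hj])
        (if_neg (by omega)) (if_neg (by omega)) (fun _ => 0) (fun _ => 0)
      rw [Finset.sum_eq_single_of_mem k (Finset.mem_range.2 hk)
        (fun j _ hj => by simp [hj])] at this
      simpa using this
  · rintro ⟨h1, h2⟩ δq hq h0 hN' δv δp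
    refine (aux_sum L hL N q v p δq h0 hN' δv δp).congr_deriv ?_
    refine Finset.sum_eq_zero fun k hk => ?_
    have hk := Finset.mem_range.1 hk
    have e : (p k + D1 L (q k) (v k)) (δq k) = 0 := by
      rcases Nat.eq_zero_or_pos k with rfl | hpos
      · rw [h0, map_zero]
      · exact h2 k hpos hk _ (hq k hk.le)
    rw [e, (h1 k hk).1, (h1 k hk).2]
    simp
end

section
/- (Closedness of the Dirac differential one-form.) Let L : ℝⁿ × ℝⁿ → ℝ be three times continuously differentiable. Define the one-form ω on ℝⁿ × ℝⁿ by ω(q,v)(δq,δv) = −D₁L(q,v)(δq) + [D(D₂L)(q,v)(δq,δv)](v), where D(D₂L)(q,v) denotes the Fréchet derivative at (q,v) of the map (q,v) ↦ D₂L(q,v). Then ω is closed: for every x = (q,v) and all u, w ∈ ℝⁿ × ℝⁿ, (Dω(x)(u))(w) = (Dω(x)(w))(u), where Dω(x) is the Fréchet derivative of ω at x. -/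
open scoped BigOperators

/-- Closedness of the Dirac differential one-form: for a C³ Lagrangian
`L : ℝⁿ × ℝⁿ → ℝ`, the one-form
`ω(q,v)(δq,δv) = −D₁L(q,v)(δq) + [D(D₂L)(q,v)(δq,δv)](v)` is closed, i.e.
its Fréchet derivative is symmetric. -/
theorem dirac_differential_one_form_closed {n : ℕ}
    (L : (Fin n → ℝ) × (Fin n → ℝ) → ℝ) (hL : ContDiff ℝ 3 L)
    (ω : (Fin n → ℝ) × (Fin n → ℝ) → ((Fin n → ℝ) × (Fin n → ℝ)) →L[ℝ] ℝ)
    (hω : ∀ x u : (Fin n → ℝ) × (Fin n → ℝ),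
      ω x u = - D1 L x.1 x.2 u.1 +
        (fderiv ℝ (fun y : (Fin n → ℝ) × (Fin n → ℝ) => D2 L y.1 y.2) x u) x.2) :
    ∀ x u w : (Fin n → ℝ) × (Fin n → ℝ),
      (fderiv ℝ ω x u) w = (fderiv ℝ ω x w) u := by
  have hd : Differentiable ℝ L := hL.differentiable (by norm_num)
  have h1 : ∀ x u : (Fin n → ℝ) × (Fin n → ℝ), D1 L x.1 x.2 u.1 = fderiv ℝ L x (u.1, 0) := by
    intro x u
    have h := (hd (x.1, x.2)).hasFDerivAt.comp x.1 (hasFDerivAt_prodMk_left (𝕜 := ℝ) x.1 x.2)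
    have h' : D1 L x.1 x.2 = _ := h.fderiv
    rw [h']
    simp
  have h2 : (fun y : (Fin n → ℝ) × (Fin n → ℝ) => D2 L y.1 y.2) =
      fun y => (fderiv ℝ L y).comp (ContinuousLinearMap.inr ℝ (Fin n → ℝ) (Fin n → ℝ)) := by
    funext x
    have h := (hd (x.1, x.2)).hasFDerivAt.comp x.2 (hasFDerivAt_prodMk_right (𝕜 := ℝ) x.1 x.2)
    exact h.fderiv
  have hfd : ContDiff ℝ 2 (fderiv ℝ L) := hL.fderiv_right (by norm_num)
  have hG : ContDiff ℝ 2 (fun y : (Fin n → ℝ) × (Fin n → ℝ) => D2 L y.1 y.2) := by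
    rw [h2]
    exact hfd.clm_comp contDiff_const
  have hGd := hG.differentiable (by norm_num)
  have hE : ContDiff ℝ 2 (fun y : (Fin n → ℝ) × (Fin n → ℝ) => D2 L y.1 y.2 y.2 - L y) :=
    (hG.clm_apply contDiff_snd).sub (hL.of_le (by norm_num))
  have key : ω = fderiv ℝ (fun y : (Fin n → ℝ) × (Fin n → ℝ) => D2 L y.1 y.2 y.2 - L y) := by
    funext x
    have h := ((hGd x).hasFDerivAt.clm_apply (hasFDerivAt_snd (𝕜 := ℝ) (p := x))).sub
      (hd x).hasFDerivAt
    have h' := h.fderiv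
    refine Eq.trans ?_ h'.symm
    refine ContinuousLinearMap.ext fun u => ?_
    rw [hω, h1]
    have h3 : D2 L x.1 x.2 u.2 = fderiv ℝ L x (0, u.2) := by
      have this : D2 L x.1 x.2 = _ := congrFun h2 x
      rw [this]
      simp
    have h4 : fderiv ℝ L x u = fderiv ℝ L x (u.1, 0) + fderiv ℝ L x (0, u.2) := by
      rw [← map_add]
      simp
    simp [h3, h4]
    ring
  intro x u w
  rw [key]
  exact (hE.contDiffAt.isSymmSndFDerivAt (by simp)) u w
end

section
/- (Discrete energy conservation for the (−)-discrete Heisenberg system.) Let h > 0 and let x, y, z, μ : ℕ → ℝ satisfy, for every k ∈ ℕ: (2x_{k+1} − x_k − x_{k+2})/h = −μ_{k+1}·y_{k+1}, (2y_{k+1} − y_k − y_{k+2})/h = μ_{k+1}·x_{k+1}, (2z_{k+1} − z_k − z_{k+2})/h = μ_{k+1}, and the (−)-discrete constraint (z_{k+1}−z_k)/h = y_k·(x_{k+1}−x_k)/h − x_k·(y_{k+1}−y_k)/h. Then the discrete energy E_k is constant: E_k = E_0 for all k ∈ ℕ. -/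
/-- Discrete energy conservation for the (−)-discrete Heisenberg system. -/
theorem minus_discrete_heisenberg_energy_conservation (h : ℝ) (hh : 0 < h)
    (x y z μ : ℕ → ℝ)
    (h1 : ∀ k : ℕ, (2 * x (k + 1) - x k - x (k + 2)) / h = - μ (k + 1) * y (k + 1))
    (h2 : ∀ k : ℕ, (2 * y (k + 1) - y k - y (k + 2)) / h = μ (k + 1) * x (k + 1))
    (h3 : ∀ k : ℕ, (2 * z (k + 1) - z k - z (k + 2)) / h = μ (k + 1))
    (h4 : ∀ k : ℕ, (z (k + 1) - z k) / h =
      y k * (x (k + 1) - x k) / h - x k * (y (k + 1) - y k) / h) :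
    ∀ k : ℕ,
      (1 / h) * ((x (k + 1) - x k) ^ 2 + (y (k + 1) - y k) ^ 2 + (z (k + 1) - z k) ^ 2) =
        (1 / h) * ((x 1 - x 0) ^ 2 + (y 1 - y 0) ^ 2 + (z 1 - z 0) ^ 2) := by
  have hne : h ≠ 0 := hh.ne'
  intro k
  induction k with
  | zero => simp
  | succ k ih =>
    rw [← ih]
    congr 1
    have e1 := h1 k
    have e2 := h2 k
    have e3 := h3 k
    have c0 := h4 k
    have c1 := h4 (k + 1)
    rw [← sub_div, div_left_inj' hne] at c0 c1
    rw [div_eq_iff hne] at e1 e2 e3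
    rw [show k + 1 + 1 = k + 2 from rfl] at *
    linear_combination (-(x (k+2) - x k)) * e1 - (y (k+2) - y k) * e2
      - (z (k+2) - z k) * e3 - (μ (k+1) * h) * c0 - (μ (k+1) * h) * c1
end

section
/- (Discrete energy conservation for the (+)-discrete Heisenberg system.) Let h > 0 and let x, y, z, μ : ℕ → ℝ satisfy, for every k ∈ ℕ: (2x_{k+1} − x_k − x_{k+2})/h = −μ_{k+1}·y_{k+1}, (2y_{k+1} − y_k − y_{k+2})/h = μ_{k+1}·x_{k+1}, (2z_{k+1} − z_k − z_{k+2})/h = μ_{k+1}, and the (+)-discrete constraint (z_{k+1}−z_k)/h = y_{k+1}·(x_{k+1}−x_k)/h − x_{k+1}·(y_{k+1}−y_k)/h. Then the discrete energy E_k is constant: E_k = E_0 for all k ∈ ℕ. -/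
/-- Discrete energy conservation for the (+)-discrete Heisenberg system. -/
theorem plus_discrete_heisenberg_energy_conservation (h : ℝ) (hh : 0 < h)
    (x y z μ : ℕ → ℝ)
    (h1 : ∀ k : ℕ, (2 * x (k + 1) - x k - x (k + 2)) / h = - μ (k + 1) * y (k + 1))
    (h2 : ∀ k : ℕ, (2 * y (k + 1) - y k - y (k + 2)) / h = μ (k + 1) * x (k + 1))
    (h3 : ∀ k : ℕ, (2 * z (k + 1) - z k - z (k + 2)) / h = μ (k + 1))
    (h4 : ∀ k : ℕ, (z (k + 1) - z k) / h =
      y (k + 1) * (x (k + 1) - x k) / h - x (k + 1) * (y (k + 1) - y k) / h) :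
    ∀ k : ℕ,
      (1 / h) * ((x (k + 1) - x k) ^ 2 + (y (k + 1) - y k) ^ 2 + (z (k + 1) - z k) ^ 2) =
        (1 / h) * ((x 1 - x 0) ^ 2 + (y 1 - y 0) ^ 2 + (z 1 - z 0) ^ 2) := by
  have hne : h ≠ 0 := hh.ne'
  intro k
  induction k with
  | zero => rfl
  | succ k ih =>
    rw [← ih]
    have e1 := h1 k
    have e2 := h2 k
    have e3 := h3 k
    have c1 := h4 k
    have c2 := h4 (k + 1)
    rw [div_eq_iff hne] at e1 e2 e3
    rw [← sub_div, div_left_inj' hne] at c1 c2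
    simp only [show k + 1 + 1 = k + 2 from rfl] at c2 ⊢
    congr 1
    linear_combination (-(x (k + 2) - x k)) * e1 - (y (k + 2) - y k) * e2
      - (z (k + 2) - z k) * e3 - (μ (k + 1) * h) * c1 - (μ (k + 1) * h) * c2
end

section
/- (Discrete Hamilton's principle.) Let L_d : ℝⁿ × ℝⁿ → ℝ be differentiable, N ≥ 1, and q₀,…,q_N ∈ ℝⁿ. Then the following are equivalent: (a) for every δq₀,…,δq_N ∈ ℝⁿ with δq₀ = δq_N = 0, the function ε ↦ Σ_{k=0}^{N−1} L_d(q_k + ε δq_k, q_{k+1} + ε δq_{k+1}) has derivative 0 at ε = 0; (b) the discrete Euler–Lagrange equations hold: D₂L_d(q_{k−1}, q_k) + D₁L_d(q_k, q_{k+1}) = 0 for k = 1,…,N−1. -/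
open scoped BigOperators

theorem hasDerivAt_aux {n : ℕ} (L : (Fin n → ℝ) × (Fin n → ℝ) → ℝ) (hL : Differentiable ℝ L)
    (a b u v : Fin n → ℝ) :
    HasDerivAt (fun ε : ℝ => L (a + ε • u, b + ε • v)) (D1 L a b u + D2 L a b v) 0 := by
  have h0 : HasFDerivAt L (fderiv ℝ L (a, b)) (a, b) := (hL (a, b)).hasFDerivAt
  have h1 : D1 L a b = (fderiv ℝ L (a, b)).comp
      (ContinuousLinearMap.inl ℝ (Fin n → ℝ) (Fin n → ℝ)) :=
    (h0.comp a (hasFDerivAt_prodMk_left a b)).fderiv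
  have h2 : D2 L a b = (fderiv ℝ L (a, b)).comp
      (ContinuousLinearMap.inr ℝ (Fin n → ℝ) (Fin n → ℝ)) :=
    (h0.comp b (hasFDerivAt_prodMk_right a b)).fderiv
  have hu : ∀ c w : Fin n → ℝ, HasDerivAt (fun ε : ℝ => c + ε • w) w 0 := by
    intro c w
    simpa using ((hasDerivAt_id (0 : ℝ)).smul_const w).const_add c
  have h3 := (hu a u).prodMk (hu b v)
  have h4 : HasFDerivAt L (fderiv ℝ L (a, b)) (a + (0 : ℝ) • u, b + (0 : ℝ) • v) := by
    simpa using h0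
  have h5 := h4.comp_hasDerivAt (0 : ℝ) h3
  have h6 : D1 L a b u + D2 L a b v = fderiv ℝ L (a, b) (u, v) := by
    rw [h1, h2]
    simp [← map_add]
  rw [h6]
  exact h5

theorem sum_aux {n : ℕ} (L : (Fin n → ℝ) × (Fin n → ℝ) → ℝ)
    (M : ℕ) (q d : ℕ → Fin n → ℝ) (h0 : d 0 = 0) :
    ∑ k ∈ Finset.range (M + 1),
      (D1 L (q k) (q (k + 1)) (d k) + D2 L (q k) (q (k + 1)) (d (k + 1)))
    = ∑ k ∈ Finset.range M,
        (D2 L (q k) (q (k + 1)) + D1 L (q (k + 1)) (q (k + 1 + 1))) (d (k + 1))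
      + D2 L (q M) (q (M + 1)) (d (M + 1)) := by
  rw [Finset.sum_add_distrib, Finset.sum_range_succ', Finset.sum_range_succ _ M, h0]
  simp only [add_apply, Finset.sum_add_distrib, map_zero]
  ring

/-- Discrete Hamilton's principle: a discrete path is a critical point of the
discrete action sum with respect to variations vanishing at the endpoints if
and only if it satisfies the discrete Euler–Lagrange equations. -/
theorem discrete_hamilton_principle {n : ℕ}
    (L : (Fin n → ℝ) × (Fin n → ℝ) → ℝ) (hL : Differentiable ℝ L)
    (N : ℕ) (hN : 1 ≤ N) (q : ℕ → Fin n → ℝ) :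
    (∀ δq : ℕ → Fin n → ℝ, δq 0 = 0 → δq N = 0 →
      HasDerivAt (fun ε : ℝ => ∑ k ∈ Finset.range N,
        L (q k + ε • δq k, q (k + 1) + ε • δq (k + 1))) 0 0)
    ↔ (∀ k : ℕ, 1 ≤ k → k < N →
        D2 L (q (k - 1)) (q k) + D1 L (q k) (q (k + 1)) = 0) := by
  obtain ⟨M, rfl⟩ : ∃ M, N = M + 1 := ⟨N - 1, by omega⟩
  have key : ∀ d : ℕ → Fin n → ℝ, d 0 = 0 → d (M + 1) = 0 →
      HasDerivAt (fun ε : ℝ => ∑ k ∈ Finset.range (M + 1),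
        L (q k + ε • d k, q (k + 1) + ε • d (k + 1)))
        (∑ k ∈ Finset.range M,
          (D2 L (q k) (q (k + 1)) + D1 L (q (k + 1)) (q (k + 1 + 1))) (d (k + 1))) 0 := by
    intro d h0 h1
    have h := HasDerivAt.fun_sum (u := Finset.range (M + 1)) (x := (0 : ℝ))
      (fun k _ => hasDerivAt_aux L hL (q k) (q (k + 1)) (d k) (d (k + 1)))
    rw [sum_aux L M q d h0, h1, map_zero, add_zero] at h
    exact h
  constructor
  · intro H k hk hkN
    obtain ⟨j, rfl⟩ : ∃ j, k = j + 1 := ⟨k - 1, by omega⟩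
    refine ContinuousLinearMap.ext fun v => ?_
    have h0 : (Pi.single (j + 1) v : ℕ → Fin n → ℝ) 0 = 0 := by
      have hne : (0 : ℕ) ≠ j + 1 := by omega
      rw [Pi.single_eq_of_ne hne]
    have h1 : (Pi.single (j + 1) v : ℕ → Fin n → ℝ) (M + 1) = 0 := by
      have hne : M + 1 ≠ j + 1 := by omega
      rw [Pi.single_eq_of_ne hne]
    have h := (key _ h0 h1).unique (H _ h0 h1)
    rw [Finset.sum_eq_single j] at h
    · simpa using h
    · intro i _ hi
      have hne : i + 1 ≠ j + 1 := by omega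
      rw [Pi.single_eq_of_ne hne, map_zero]
    · intro hj
      exact absurd (Finset.mem_range.2 (by omega)) hj
  · intro H d h0 h1
    have h := key d h0 h1
    rw [Finset.sum_eq_zero] at h
    · exact h
    · intro k hk
      have hk' := Finset.mem_range.1 hk
      have := H (k + 1) (by omega) (by omega)
      rw [Nat.add_sub_cancel] at this
      rw [this]
      rfl
end

section
/- (Discrete Lagrange–d'Alembert principle.) Let L_d : ℝⁿ × ℝⁿ → ℝ be differentiable, N ≥ 1, and q₀,…,q_N ∈ ℝⁿ. Then the following are equivalent: (a) for every δq₀,…,δq_N ∈ ℝⁿ with δq_k ∈ Δ(q_k) for all k and δq₀ = δq_N = 0, the function ε ↦ Σ_{k=0}^{N−1} L_d(q_k + ε δq_k, q_{k+1} + ε δq_{k+1}) has derivative 0 at ε = 0; (b) the discrete Lagrange–d'Alembert equations hold: D₂L_d(q_{k−1}, q_k) + D₁L_d(q_k, q_{k+1}) ∈ Δ°(q_k) for k = 1,…,N−1. -/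
open scoped BigOperators

theorem dLA_hasDerivAt {n : ℕ}
    (L : (Fin n → ℝ) × (Fin n → ℝ) → ℝ) (hL : Differentiable ℝ L)
    (M : ℕ) (q δq : ℕ → Fin n → ℝ) (h0 : δq 0 = 0) (h1 : δq (M + 1) = 0) :
    HasDerivAt (fun ε : ℝ => ∑ k ∈ Finset.range (M + 1),
        L (q k + ε • δq k, q (k + 1) + ε • δq (k + 1)))
      (∑ k ∈ Finset.range M,
        (D2 L (q k) (q (k + 1)) + D1 L (q (k + 1)) (q (k + 2))) (δq (k + 1))) 0 := by
  have key : ∀ a b u v : Fin n → ℝ,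
      HasDerivAt (fun ε : ℝ => L (a + ε • u, b + ε • v)) (D1 L a b u + D2 L a b v) 0 := by
    intro a b u v
    have hl : D1 L a b u = fderiv ℝ L (a, b) (u, 0) := by
      have := (hL (a, b)).hasFDerivAt.comp a (hasFDerivAt_prodMk_left (𝕜 := ℝ) a b)
      have h2 : D1 L a b = _ := this.fderiv
      rw [h2]; simp
    have hr : D2 L a b v = fderiv ℝ L (a, b) (0, v) := by
      have := (hL (a, b)).hasFDerivAt.comp b (hasFDerivAt_prodMk_right (𝕜 := ℝ) a b)
      have h2 : D2 L a b = _ := this.fderiv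
      rw [h2]; simp
    have hc : ∀ c w : Fin n → ℝ, HasDerivAt (fun ε : ℝ => c + ε • w) w 0 := by
      intro c w
      simpa using ((hasDerivAt_id (0 : ℝ)).smul_const w).const_add c
    have hp := (hc a u).prodMk (hc b v)
    have hF : HasFDerivAt L (fderiv ℝ L (a, b)) (a + (0 : ℝ) • u, b + (0 : ℝ) • v) := by
      simpa using (hL (a, b)).hasFDerivAt
    have := hF.comp_hasDerivAt (0 : ℝ) hp
    rw [hl, hr, ← map_add]
    simpa [Function.comp_def] using this
  have hs := HasDerivAt.fun_sum (u := Finset.range (M + 1))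
    (fun k _ => key (q k) (q (k + 1)) (δq k) (δq (k + 1)))
  refine hs.congr_deriv ?_
  rw [Finset.sum_add_distrib, Finset.sum_range_succ', Finset.sum_range_succ _ M, h0, h1]
  simp only [map_zero, add_zero, ← Finset.sum_add_distrib, add_apply]
  exact Finset.sum_congr rfl fun k _ => add_comm _ _

/-- The discrete Lagrange–d'Alembert principle: a discrete path is a critical
point of the discrete action sum with respect to variations lying in the
constraint distribution and vanishing at the endpoints if and only if it
satisfies the discrete Lagrange–d'Alembert equations. -/
theorem discrete_lagrange_dalembert_principle {n : ℕ}
    (Δ : (Fin n → ℝ) → Submodule ℝ (Fin n → ℝ))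
    (L : (Fin n → ℝ) × (Fin n → ℝ) → ℝ) (hL : Differentiable ℝ L)
    (N : ℕ) (hN : 1 ≤ N) (q : ℕ → Fin n → ℝ) :
    (∀ δq : ℕ → Fin n → ℝ, (∀ k ≤ N, δq k ∈ Δ (q k)) → δq 0 = 0 → δq N = 0 →
      HasDerivAt (fun ε : ℝ => ∑ k ∈ Finset.range N,
        L (q k + ε • δq k, q (k + 1) + ε • δq (k + 1))) 0 0)
    ↔ (∀ k : ℕ, 1 ≤ k → k < N →
        D2 L (q (k - 1)) (q k) + D1 L (q k) (q (k + 1)) ∈ ann Δ (q k)) := by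
  obtain ⟨M, rfl⟩ : ∃ M, N = M + 1 := ⟨N - 1, by omega⟩
  constructor
  · intro h k hk hkN v hv
    obtain ⟨j, rfl⟩ : ∃ j, k = j + 1 := ⟨k - 1, by omega⟩
    have h0 : (Pi.single (j + 1) v : ℕ → Fin n → ℝ) 0 = 0 :=
      Pi.single_eq_of_ne (by omega) _
    have h1 : (Pi.single (j + 1) v : ℕ → Fin n → ℝ) (M + 1) = 0 :=
      Pi.single_eq_of_ne (by omega) _
    have hd := h (Pi.single (j + 1) v) (by
      intro i _
      by_cases hi : i = j + 1
      · subst hi; simpa using hv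
      · rw [Pi.single_eq_of_ne hi]; exact zero_mem _) h0 h1
    have hu := hd.unique (dLA_hasDerivAt L hL M q _ h0 h1)
    rw [Finset.sum_eq_single j] at hu
    · rw [Pi.single_eq_same] at hu
      exact hu.symm
    · intro i _ hi
      rw [Pi.single_eq_of_ne (by omega), map_zero]
    · intro hj
      exact absurd (Finset.mem_range.mpr (by omega)) hj
  · intro h δq hδ h0 h1
    have hd := dLA_hasDerivAt L hL M q δq h0 h1
    rwa [Finset.sum_eq_zero] at hd
    intro k hk
    have hk' := Finset.mem_range.mp hk
    exact h (k + 1) (by omega) (by omega) _ (hδ (k + 1) (by omega))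
end
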